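/- arXiv:1705.08126 — 2 statements merged into one kernel-verified Lean document; each statement's English description precedes it below -/
import Mathlib

section
/- Let u, u̇ ∈ ℍ with |u| = 1 and ⟨u, u̇⟩ = 0. Then ⟨ū𝐤u, conj(u̇)·𝐢·u + ū·𝐢·u̇⟩ = −2⟨u, 𝐣·u̇⟩. That is, the pullback of the Liouville–Cartan form λ₁ on ST*S² under the double covering Φ(u) = (ū𝐢u, ū𝐤u) equals the contact form α_𝐣 on S³. -/
open Quaternion
open scoped RealInnerProductSpace

/-- The quaternionic unit `𝐢`. -/
noncomputable def qI : ℍ[ℝ] := ⟨0, 1, 0, 0⟩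
/-- The quaternionic unit `𝐣`. -/
noncomputable def qJ : ℍ[ℝ] := ⟨0, 0, 1, 0⟩
/-- The quaternionic unit `𝐤`. -/
noncomputable def qK : ℍ[ℝ] := ⟨0, 0, 0, 1⟩

/-- For `u, u̇ ∈ ℍ` with `|u| = 1` and `⟨u, u̇⟩ = 0` one has
`⟨ū𝐤u, conj(u̇)𝐢u + ū𝐢u̇⟩ = −2⟨u, 𝐣u̇⟩`: the pullback of the Liouville–Cartan form `λ₁` on
`ST*S²` under the double covering `Φ(u) = (ū𝐢u, ū𝐤u)` equals the contact form `α_𝐣`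
on `S³`. -/
theorem pullback_liouville_cartan_one (u v : ℍ[ℝ]) (hu : ‖u‖ = 1) (hv : ⟪u, v⟫ = 0) :
    ⟪star u * qK * u, star v * qI * u + star u * qI * v⟫ = -2 * ⟪u, qJ * v⟫ := by
  have h : u.re * u.re + u.imI * u.imI + u.imJ * u.imJ + u.imK * u.imK = 1 := by
    have h1 : ⟪u, u⟫ = 1 := by rw [real_inner_self_eq_norm_sq, hu]; norm_num
    simp only [Quaternion.inner_def, Quaternion.re_mul, Quaternion.re_star,
      Quaternion.imI_star, Quaternion.imJ_star, Quaternion.imK_star] at h1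
    linarith
  have i0 : qI.re = 0 := rfl
  have i1 : qI.imI = 1 := rfl
  have i2 : qI.imJ = 0 := rfl
  have i3 : qI.imK = 0 := rfl
  have j0 : qJ.re = 0 := rfl
  have j1 : qJ.imI = 0 := rfl
  have j2 : qJ.imJ = 1 := rfl
  have j3 : qJ.imK = 0 := rfl
  have k0 : qK.re = 0 := rfl
  have k1 : qK.imI = 0 := rfl
  have k2 : qK.imJ = 0 := rfl
  have k3 : qK.imK = 1 := rfl
  simp only [Quaternion.inner_def, Quaternion.re_mul, Quaternion.imI_mul, Quaternion.imJ_mul,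
    Quaternion.imK_mul, Quaternion.re_star, Quaternion.imI_star, Quaternion.imJ_star,
    Quaternion.imK_star, Quaternion.re_add, Quaternion.imI_add, Quaternion.imJ_add,
    Quaternion.imK_add, i0, i1, i2, i3, j0, j1, j2, j3, k0, k1, k2, k3]
  linear_combination (-2 * (-u.re * v.imJ + u.imI * v.imK + u.imJ * v.re - u.imK * v.imI)) * h
end

section
/- Let p ∈ ℍ with |p| = 1, and let v, w ∈ ℍ with ⟨p,v⟩ = 0 and ⟨p,w⟩ = 0. Then −4⟨v, 𝐢·w⟩ = 4(⟨p, 𝐣·v⟩⟨p, 𝐤·w⟩ − ⟨p, 𝐣·w⟩⟨p, 𝐤·v⟩). That is, the structure equation dα_𝐢 = α_𝐣 ∧ α_𝐤 holds on the tangent bundle of S³, where the left-hand side is the exterior derivative of the 1-form p ↦ (v ↦ −2⟨p,𝐢v⟩) evaluated on tangent vectors v, w at p. -/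
open Quaternion
open scoped RealInnerProductSpace

/-- Let `p ∈ S³` and let `v, w` be tangent to `S³` at `p`.  Then
`−4⟨v, 𝐢w⟩ = 4(⟨p, 𝐣v⟩⟨p, 𝐤w⟩ − ⟨p, 𝐣w⟩⟨p, 𝐤v⟩)`: the structure equation
`dα_𝐢 = α_𝐣 ∧ α_𝐤` holds on the tangent bundle of `S³`. -/
theorem structure_equation_d_alpha_i (p v w : ℍ[ℝ]) (hp : ‖p‖ = 1)
    (hv : ⟪p, v⟫ = 0) (hw : ⟪p, w⟫ = 0) :
    -4 * ⟪v, qI * w⟫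
      = 4 * (⟪p, qJ * v⟫ * ⟪p, qK * w⟫ - ⟪p, qJ * w⟫ * ⟪p, qK * v⟫) := by
  have hN : ⟪p, p⟫ = 1 := by
    rw [real_inner_self_eq_norm_sq, hp]; norm_num
  have key : ∀ a b : ℍ[ℝ], ⟪a, b⟫
      = a.re * b.re + a.imI * b.imI + a.imJ * b.imJ + a.imK * b.imK := by
    intro a b
    rw [Quaternion.inner_def]
    simp only [Quaternion.re_mul, Quaternion.re_star, Quaternion.imI_star,
      Quaternion.imJ_star, Quaternion.imK_star]
    ring
  rw [key] at hN hv hw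
  simp only [key, Quaternion.re_mul, Quaternion.imI_mul, Quaternion.imJ_mul,
    Quaternion.imK_mul]
  simp only [qI, qJ, qK]
  obtain ⟨p0, p1, p2, p3⟩ := p
  obtain ⟨v0, v1, v2, v3⟩ := v
  obtain ⟨w0, w1, w2, w3⟩ := w
  simp only at *
  linear_combination (4 * (-v0 * w1 + v1 * w0 - v2 * w3 + v3 * w2)) * hN
    - 4 * (-p0 * w1 + p1 * w0 - p2 * w3 + p3 * w2) * hv
    + 4 * (-p0 * v1 + p1 * v0 - p2 * v3 + p3 * v2) * hw
end
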